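/- arXiv:2203.16733 — 3 statements merged into one kernel-verified Lean document; each statement's English description precedes it below -/
import Mathlib

section
/- Let a, D, λ, l̄ > 0, set M := (λ/2)·(1/a + l̄/D), and let n ≥ 0 be an integer. Let G : T₁ → ℝ be continuous with |G(τ,s)| ≤ M^{n+1}·(τ+s)^n / n! for all (τ,s) ∈ T₁. Then |F[G](ξ,η)| ≤ M^{n+2}·(ξ+η)^{n+1} / (n+1)! for all (ξ,η) ∈ T₁. -/
/-- The region `T₁ = {(ξ,η) : 0 ≤ ξ ≤ 2l̄, 0 ≤ η ≤ min(ξ, 2l̄ - ξ)}`. -/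
def T1 (lbar : ℝ) : Set (ℝ × ℝ) :=
  {p : ℝ × ℝ | 0 ≤ p.1 ∧ p.1 ≤ 2 * lbar ∧ 0 ≤ p.2 ∧ p.2 ≤ min p.1 (2 * lbar - p.1)}

/-- The successive-approximation operator
`F[G](ξ,η) = (λ/(4D)) ∫₀^η e^{(a/(2D))(τ-η)} (∫₀^τ G(τ,s) ds) dτ
           + (λ/(8D)) ∫_η^ξ (∫₀^η G(τ,s) ds) dτ`. -/
noncomputable def Fop (a D lam : ℝ) (G : ℝ × ℝ → ℝ) (ξ η : ℝ) : ℝ :=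
  lam / (4 * D) * (∫ τ in (0:ℝ)..η,
      Real.exp (a / (2 * D) * (τ - η)) * ∫ s in (0:ℝ)..τ, G (τ, s))
    + lam / (8 * D) * ∫ τ in η..ξ, ∫ s in (0:ℝ)..η, G (τ, s)

lemma inner_bound (G : ℝ × ℝ → ℝ) (C τ b : ℝ) (n : ℕ) (hC : 0 ≤ C) (hτ : 0 ≤ τ) (hb : 0 ≤ b)
    (h : ∀ s ∈ Set.Ioc 0 b, |G (τ, s)| ≤ C * (τ + s) ^ n) :
    |∫ s in (0:ℝ)..b, G (τ, s)| ≤ C * (τ + b) ^ (n + 1) / (n + 1) := by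
  have h1 : ‖∫ s in (0:ℝ)..b, G (τ, s)‖ ≤ ∫ s in (0:ℝ)..b, C * (τ + s) ^ n := by
    apply intervalIntegral.norm_integral_le_of_norm_le hb
    · exact Filter.Eventually.of_forall (fun s hs => h s hs)
    · apply Continuous.intervalIntegrable
      fun_prop
  have h2 : ∫ s in (0:ℝ)..b, C * (τ + s) ^ n
      = C * (((τ + b) ^ (n + 1) - τ ^ (n + 1)) / (n + 1)) := by
    rw [intervalIntegral.integral_const_mul,
      intervalIntegral.integral_comp_add_left (fun x => x ^ n) τ, integral_pow, add_zero]
  rw [Real.norm_eq_abs, h2] at h1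
  refine h1.trans ?_
  rw [mul_div_assoc]
  gcongr
  linarith [pow_nonneg hτ (n + 1)]

lemma exp_bound (k η : ℝ) (hk : 0 < k) :
    ∫ τ in (0:ℝ)..η, Real.exp (k * (τ - η)) ≤ 1 / k := by
  have : ∫ τ in (0:ℝ)..η, Real.exp (k * (τ - η))
      = Real.exp (k * (η - η)) / k - Real.exp (k * (0 - η)) / k := by
    apply intervalIntegral.integral_eq_sub_of_hasDerivAt (f := fun x => Real.exp (k * (x - η)) / k)
    · intro x _
      have h := ((((hasDerivAt_id x).sub_const η).const_mul k).exp).div_const k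
      have e : Real.exp (k * (x - η)) * (k * 1) / k = Real.exp (k * (x - η)) := by
        field_simp
      exact e ▸ h
    · apply Continuous.intervalIntegrable
      fun_prop
  rw [this]
  simp only [sub_self, mul_zero, Real.exp_zero]
  have : 0 < Real.exp (k * (0 - η)) / k := by positivity
  linarith

/-- with `M = (λ/2)(1/a + l̄/D)`, if `G` is continuous on `T₁` with
`|G(τ,s)| ≤ M^{n+1}(τ+s)^n/n!` on `T₁`, then
`|F[G](ξ,η)| ≤ M^{n+2}(ξ+η)^{n+1}/(n+1)!` on `T₁`. -/
theorem successive_approx_bound (a D lam lbar : ℝ) (ha : 0 < a) (hD : 0 < D)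
    (hlam : 0 < lam) (hlbar : 0 < lbar) (n : ℕ)
    (M : ℝ) (hM : M = lam / 2 * (1 / a + lbar / D))
    (G : ℝ × ℝ → ℝ) (hGcont : ContinuousOn G (T1 lbar))
    (hGbd : ∀ p ∈ T1 lbar, |G p| ≤ M ^ (n + 1) * (p.1 + p.2) ^ n / n.factorial) :
    ∀ p ∈ T1 lbar,
      |Fop a D lam G p.1 p.2| ≤ M ^ (n + 2) * (p.1 + p.2) ^ (n + 1) / (n + 1).factorial := by
  rintro ⟨ξ, η⟩ ⟨h0, h1, h2, h3⟩
  simp only at h0 h1 h2 h3 ⊢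
  have h4 := h3.trans (min_le_left _ _)
  have h5 := h3.trans (min_le_right _ _)
  have hMpos : 0 < M := by rw [hM]; positivity
  set C : ℝ := M ^ (n + 1) / n.factorial with hCdef
  have hC : 0 ≤ C := by positivity
  have hG : ∀ τ s : ℝ, 0 ≤ s → s ≤ τ → s ≤ 2 * lbar - τ → |G (τ, s)| ≤ C * (τ + s) ^ n := by
    intro τ s a1 a2 a3
    have := hGbd (τ, s) ⟨a1.trans a2, by simp only; linarith, a1, le_min a2 a3⟩
    rw [hCdef, div_mul_eq_mul_div]
    exact this
  set K : ℝ := C * (ξ + η) ^ (n + 1) / (n + 1) with hK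
  have hKnn : 0 ≤ K := by positivity
  have hfst : |∫ τ in (0:ℝ)..η, Real.exp (a / (2 * D) * (τ - η)) * ∫ s in (0:ℝ)..τ, G (τ, s)|
      ≤ 2 * D / a * K := by
    have hle : ‖∫ τ in (0:ℝ)..η, Real.exp (a / (2 * D) * (τ - η)) * ∫ s in (0:ℝ)..τ, G (τ, s)‖
        ≤ ∫ τ in (0:ℝ)..η, Real.exp (a / (2 * D) * (τ - η)) * K := by
      apply intervalIntegral.norm_integral_le_of_norm_le h2
      · refine Filter.Eventually.of_forall (fun τ hτ => ?_)
        rw [Real.norm_eq_abs, abs_mul, Real.abs_exp]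
        gcongr
        refine (inner_bound G C τ τ n hC hτ.1.le hτ.1.le ?_).trans ?_
        · intro s hs
          exact hG τ s hs.1.le hs.2 (by linarith [hs.2, hτ.2])
        · have := hτ.1
          have := hτ.2
          rw [hK]
          gcongr
          linarith
      · apply Continuous.intervalIntegrable
        fun_prop
    rw [intervalIntegral.integral_mul_const, Real.norm_eq_abs] at hle
    refine hle.trans ?_
    gcongr
    have := exp_bound (a / (2 * D)) η (by positivity)
    rwa [one_div_div] at this
  have hsnd : |∫ τ in η..ξ, ∫ s in (0:ℝ)..η, G (τ, s)| ≤ K * (2 * lbar) := by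
    have hle : ‖∫ τ in η..ξ, ∫ s in (0:ℝ)..η, G (τ, s)‖ ≤ K * |ξ - η| := by
      apply intervalIntegral.norm_integral_le_of_norm_le_const
      intro τ hτ
      rw [Set.uIoc_of_le h4] at hτ
      have t1 := hτ.1
      have t2 := hτ.2
      refine (inner_bound G C τ η n hC (by linarith) h2 ?_).trans ?_
      · intro s hs
        exact hG τ s hs.1.le (by linarith [hs.2]) (by linarith [hs.2])
      · rw [hK]
        have : 0 ≤ τ := by linarith
        gcongr
    refine hle.trans ?_
    rw [abs_of_nonneg (by linarith)]
    gcongr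
    linarith
  have hfin : M ^ (n + 2) * (ξ + η) ^ (n + 1) / (n + 1).factorial = M * K := by
    rw [hK, hCdef, Nat.factorial_succ]
    push_cast
    field_simp
    ring
  rw [hfin, Fop]
  refine (abs_add_le _ _).trans ?_
  rw [abs_mul, abs_mul, abs_of_pos (by positivity : 0 < lam / (4 * D)),
    abs_of_pos (by positivity : 0 < lam / (8 * D))]
  calc _ ≤ lam / (4 * D) * (2 * D / a * K) + lam / (8 * D) * (K * (2 * lbar)) := by gcongr
    _ = (lam / 2 * (1 / a + lbar / D)) * K - lam * lbar / (4 * D) * K := by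
      field_simp
      ring
    _ ≤ M * K := by
      rw [← hM]
      have : 0 ≤ lam * lbar / (4 * D) * K := by positivity
      linarith
end

section
/- Let a, D, λ, l̄ > 0 and let G₀ : T₁ → ℝ be continuous. If G and G' are two continuous real-valued functions on T₁ both satisfying the integral equation G(ξ,η) = G₀(ξ,η) + F[G](ξ,η) for all (ξ,η) ∈ T₁, then G(ξ,η) = G'(ξ,η) for all (ξ,η) ∈ T₁; i.e., the solution of the integral equation is unique. -/
open MeasureTheory in
theorem inner_bound_s13 (f : ℝ → ℝ) (M k t u : ℝ) (hk : 0 < k) (hM : 0 ≤ M) (ht : 0 ≤ t) (htu : t ≤ u)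
    (h : ∀ s, 0 ≤ s → s ≤ t → |f s| ≤ M * Real.exp (k * s)) :
    |∫ s in (0:ℝ)..t, f s| ≤ M * Real.exp (k * u) / k := by
  have h1 : ‖∫ s in (0:ℝ)..t, f s‖ ≤ ∫ s in (0:ℝ)..t, M * Real.exp (k * s) := by
    apply intervalIntegral.norm_integral_le_of_norm_le ht
    · exact Filter.Eventually.of_forall fun s hs => h s hs.1.le hs.2
    · exact Continuous.intervalIntegrable (by fun_prop) _ _
  have h2 : ∫ s in (0:ℝ)..t, M * Real.exp (k * s) = M * Real.exp (k * t) / k - M / k := by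
    have := intervalIntegral.integral_eq_sub_of_hasDerivAt (a := 0) (b := t)
      (f := fun s => M * Real.exp (k * s) / k) (f' := fun s => M * Real.exp (k * s))
      (fun s _ => by
        have := (((hasDerivAt_id s).const_mul k).exp.const_mul M).div_const k
        refine this.congr_deriv ?_
        simp only [id, mul_one]
        field_simp)
      (Continuous.intervalIntegrable (by fun_prop) _ _)
    rw [this]; simp
  rw [h2, Real.norm_eq_abs] at h1
  have h3 : 0 ≤ M / k := by positivity
  have h4 : M * Real.exp (k * t) / k ≤ M * Real.exp (k * u) / k := by gcongr
  linarith

theorem T1_closed (l : ℝ) : IsClosed (T1 l) := by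
  have e : T1 l = {p : ℝ × ℝ | 0 ≤ p.1} ∩ ({p : ℝ × ℝ | p.1 ≤ 2 * l} ∩ ({p : ℝ × ℝ | 0 ≤ p.2} ∩
      {p : ℝ × ℝ | p.2 ≤ min p.1 (2 * l - p.1)})) := rfl
  rw [e]
  exact (isClosed_le (by fun_prop) (by fun_prop)).inter
    ((isClosed_le (by fun_prop) (by fun_prop)).inter
    ((isClosed_le (by fun_prop) (by fun_prop)).inter
    (isClosed_le (by fun_prop) (by fun_prop))))

theorem T1_compact (l : ℝ) : IsCompact (T1 l) := by
  refine IsCompact.of_isClosed_subset (isCompact_Icc (a := ((0:ℝ),(0:ℝ))) (b := (2*l, 2*l)))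
    (T1_closed l) ?_
  rintro ⟨x, y⟩ ⟨h1, h2, h3, h4⟩
  have := h4.trans (min_le_left _ _)
  exact ⟨⟨h1, h3⟩, ⟨h2, this.trans h2⟩⟩

theorem T1_mem1 {l x y : ℝ} (h : (x, y) ∈ T1 l) {t s : ℝ} (ht : t ≤ y) (hs : 0 ≤ s)
    (hst : s ≤ t) : (t, s) ∈ T1 l := by
  obtain ⟨h1, h2, h3, h4⟩ := h
  obtain ⟨h5, h6⟩ := le_min_iff.1 h4
  simp only at *
  refine ⟨?_, ?_, hs, le_min ?_ ?_⟩ <;> simp only <;> linarith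

theorem T1_mem2 {l x y : ℝ} (h : (x, y) ∈ T1 l) {t s : ℝ} (ht : y ≤ t) (htx : t ≤ x) (hs : 0 ≤ s)
    (hst : s ≤ y) : (t, s) ∈ T1 l := by
  obtain ⟨h1, h2, h3, h4⟩ := h
  obtain ⟨h5, h6⟩ := le_min_iff.1 h4
  simp only at *
  refine ⟨?_, ?_, hs, le_min ?_ ?_⟩ <;> simp only <;> linarith

theorem Fop_congr (a D lam l : ℝ) (G g : ℝ × ℝ → ℝ) (h : ∀ p ∈ T1 l, G p = g p) (x y : ℝ)
    (hp : (x, y) ∈ T1 l) : Fop a D lam G x y = Fop a D lam g x y := by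
  have hy : 0 ≤ y := hp.2.2.1
  have hyx : y ≤ x := hp.2.2.2.trans (min_le_left _ _)
  unfold Fop
  congr 2
  · apply intervalIntegral.integral_congr
    intro t ht
    rw [Set.uIcc_of_le hy] at ht
    simp only
    congr 1
    apply intervalIntegral.integral_congr
    intro s hs
    rw [Set.uIcc_of_le ht.1] at hs
    exact h _ (T1_mem1 hp ht.2 hs.1 hs.2)
  · apply intervalIntegral.integral_congr
    intro t ht
    rw [Set.uIcc_of_le hyx] at ht
    apply intervalIntegral.integral_congr
    intro s hs
    rw [Set.uIcc_of_le hy] at hs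
    exact h _ (T1_mem2 hp ht.1 ht.2 hs.1 hs.2)

theorem exists_ext (l : ℝ) (G : ℝ × ℝ → ℝ) (h : ContinuousOn G (T1 l)) :
    ∃ g : ℝ × ℝ → ℝ, Continuous g ∧ ∀ p ∈ T1 l, G p = g p := by
  obtain ⟨g, hg⟩ := ContinuousMap.exists_restrict_eq (T1_closed l)
    (⟨(T1 l).domRestrict G, h.domRestrict⟩ : C(T1 l, ℝ))
  refine ⟨g, g.continuous, fun p hp => ?_⟩
  have := congrArg (fun f => f ⟨p, hp⟩) hg
  exact this.symm

theorem Fop_sub (a D lam : ℝ) (g g' : ℝ × ℝ → ℝ) (h : Continuous g) (h' : Continuous g')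
    (x y : ℝ) : Fop a D lam (fun p => g p - g' p) x y = Fop a D lam g x y - Fop a D lam g' x y := by
  have key : ∀ f : ℝ × ℝ → ℝ, Continuous f → Continuous fun t : ℝ => ∫ s in (0:ℝ)..t, f (t, s) := by
    intro f hf
    exact intervalIntegral.continuous_parametric_intervalIntegral_of_continuous
      (f := fun t s => f (t, s)) (by exact hf) continuous_id
  have key2 : ∀ f : ℝ × ℝ → ℝ, Continuous f → Continuous fun t : ℝ => ∫ s in (0:ℝ)..y, f (t, s) := by
    intro f hf
    exact intervalIntegral.continuous_parametric_intervalIntegral_of_continuous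
      (f := fun t s => f (t, s)) (by exact hf) continuous_const
  have e : ∀ t u, ∫ s in (0:ℝ)..u, (g (t, s) - g' (t, s)) =
      (∫ s in (0:ℝ)..u, g (t, s)) - ∫ s in (0:ℝ)..u, g' (t, s) := fun t u =>
    intervalIntegral.integral_sub (Continuous.intervalIntegrable (by fun_prop) _ _)
      (Continuous.intervalIntegrable (by fun_prop) _ _)
  have k1 := key g h
  have k2 := key g' h'
  have k3 := key2 g h
  have k4 := key2 g' h'
  unfold Fop
  simp only [e, mul_sub]
  rw [intervalIntegral.integral_sub (Continuous.intervalIntegrable (by fun_prop) _ _)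
      (Continuous.intervalIntegrable (by fun_prop) _ _),
    intervalIntegral.integral_sub (Continuous.intervalIntegrable (by fun_prop) _ _)
      (Continuous.intervalIntegrable (by fun_prop) _ _)]
  ring

theorem Fop_bound (a D lam l : ℝ) (ha : 0 < a) (hD : 0 < D) (hlam : 0 < lam) (hl : 0 < l)
    (H : ℝ × ℝ → ℝ) (M k : ℝ) (hk : k = lam * l / D) (hM : 0 ≤ M)
    (h : ∀ p ∈ T1 l, |H p| ≤ M * Real.exp (k * p.2)) (x y : ℝ) (hp : (x, y) ∈ T1 l) :
    |Fop a D lam H x y| ≤ M / 2 * Real.exp (k * y) := by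
  have hk0 : 0 < k := by rw [hk]; positivity
  have hx0 : 0 ≤ x := hp.1
  have hx2 : x ≤ 2 * l := hp.2.1
  have hy : 0 ≤ y := hp.2.2.1
  have hyx : y ≤ x := hp.2.2.2.trans (min_le_left _ _)
  have hyx2 : y ≤ 2 * l - x := hp.2.2.2.trans (min_le_right _ _)
  have b1 : ‖∫ τ in (0:ℝ)..y, Real.exp (a / (2 * D) * (τ - y)) * ∫ s in (0:ℝ)..τ, H (τ, s)‖
      ≤ (M * Real.exp (k * y) / k) * |y - 0| := by
    apply intervalIntegral.norm_integral_le_of_norm_le_const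
    intro t ht
    rw [Set.uIoc_of_le hy] at ht
    have := inner_bound_s13 (fun s => H (t, s)) M k t y hk0 hM ht.1.le ht.2
      (fun s hs hst => h _ (T1_mem1 hp ht.2 hs hst))
    rw [norm_mul, Real.norm_eq_abs, Real.norm_eq_abs, Real.abs_exp]
    have he : Real.exp (a / (2 * D) * (t - y)) ≤ 1 := by
      rw [Real.exp_le_one_iff]
      exact mul_nonpos_of_nonneg_of_nonpos (by positivity) (by linarith [ht.2])
    calc _ ≤ 1 * _ := mul_le_mul he this (abs_nonneg _) zero_le_one
      _ = _ := one_mul _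
  have b2 : ‖∫ τ in y..x, ∫ s in (0:ℝ)..y, H (τ, s)‖
      ≤ (M * Real.exp (k * y) / k) * |x - y| := by
    apply intervalIntegral.norm_integral_le_of_norm_le_const
    intro t ht
    rw [Set.uIoc_of_le hyx] at ht
    exact inner_bound_s13 (fun s => H (t, s)) M k y y hk0 hM hy le_rfl
      (fun s hs hst => h _ (T1_mem2 hp ht.1.le ht.2 hs hst))
  rw [Real.norm_eq_abs, sub_zero, abs_of_nonneg hy] at b1
  rw [Real.norm_eq_abs, abs_of_nonneg (sub_nonneg.2 hyx)] at b2
  have hE : 0 ≤ M * Real.exp (k * y) / k := by positivity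
  have c1 := b1.trans (mul_le_mul_of_nonneg_left (show y ≤ l by linarith) hE)
  have c2 := b2.trans (mul_le_mul_of_nonneg_left (show x - y ≤ 2 * l by linarith) hE)
  unfold Fop
  refine (abs_add_le _ _).trans ?_
  rw [abs_mul, abs_mul, abs_of_pos (show 0 < lam / (4 * D) by positivity),
    abs_of_pos (show 0 < lam / (8 * D) by positivity)]
  refine (add_le_add (mul_le_mul_of_nonneg_left c1 (by positivity))
    (mul_le_mul_of_nonneg_left c2 (by positivity))).trans (le_of_eq ?_)
  generalize Real.exp (k * y) = E
  rw [hk]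
  field_simp
  ring

/-- the integral equation `G = G₀ + F[G]` has at most one continuous
solution on `T₁`. -/
theorem integral_equation_uniqueness (a D lam lbar : ℝ) (ha : 0 < a) (hD : 0 < D)
    (hlam : 0 < lam) (hlbar : 0 < lbar)
    (G₀ : ℝ × ℝ → ℝ) (hG₀cont : ContinuousOn G₀ (T1 lbar))
    (G G' : ℝ × ℝ → ℝ)
    (hGcont : ContinuousOn G (T1 lbar)) (hG'cont : ContinuousOn G' (T1 lbar))
    (hG : ∀ p ∈ T1 lbar, G p = G₀ p + Fop a D lam G p.1 p.2)
    (hG' : ∀ p ∈ T1 lbar, G' p = G₀ p + Fop a D lam G' p.1 p.2) :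
    ∀ p ∈ T1 lbar, G p = G' p := by
  obtain ⟨g, hg, hgG⟩ := exists_ext lbar G hGcont
  obtain ⟨g', hg', hgG'⟩ := exists_ext lbar G' hG'cont
  have hH : ∀ p ∈ T1 lbar, g p - g' p = Fop a D lam (fun p => g p - g' p) p.1 p.2 := by
    intro p hp
    rw [Fop_sub a D lam g g' hg hg', ← Fop_congr a D lam lbar G g hgG p.1 p.2 hp,
      ← Fop_congr a D lam lbar G' g' hgG' p.1 p.2 hp, ← hgG p hp, ← hgG' p hp, hG p hp, hG' p hp]
    ring
  set k := lam * lbar / D with hk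
  intro p hp
  obtain ⟨q, hq, hmax⟩ := (T1_compact lbar).exists_isMaxOn ⟨p, hp⟩
    (f := fun p => |g p - g' p| * Real.exp (-(k * p.2))) (Continuous.continuousOn (by fun_prop))
  set M := |g q - g' q| * Real.exp (-(k * q.2)) with hMdef
  have hM : 0 ≤ M := by positivity
  have hb : ∀ p ∈ T1 lbar, |g p - g' p| ≤ M * Real.exp (k * p.2) := by
    intro p hp
    have h1 : |g p - g' p| * Real.exp (-(k * p.2)) ≤ M := hmax hp
    rwa [Real.exp_neg, ← div_eq_mul_inv, div_le_iff₀ (Real.exp_pos _)] at h1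
  have h2 := Fop_bound a D lam lbar ha hD hlam hlbar (fun p => g p - g' p) M k hk hM hb q.1 q.2 hq
  rw [← hH q hq] at h2
  have h3 : M ≤ M / 2 := by
    rw [hMdef, Real.exp_neg, ← div_eq_mul_inv, div_le_iff₀ (Real.exp_pos _)]
    rw [hMdef, Real.exp_neg, ← div_eq_mul_inv] at h2
    exact h2
  have hM0 : M = 0 := by linarith
  have h4 := hb p hp
  rw [hM0, zero_mul] at h4
  rw [hgG p hp, hgG' p hp]
  exact sub_eq_zero.1 (abs_eq_zero.1 (le_antisymm h4 (abs_nonneg _)))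
end

section
/- Let α, β > 0 and let V : [0,∞) → ℝ be a differentiable function with V(t) ≥ 0 and V'(t) ≤ −α·V(t) + β·V(t)^{3/2} for all t ≥ 0. If V(0) < (α/(2β))², then V(t) < (α/(2β))² for all t ≥ 0, and moreover V(t) ≤ V(0)·e^{−(α/2)·t} for all t ≥ 0. -/
/-- Let `α, β > 0` and `V : [0,∞) → ℝ` differentiable with `V(t) ≥ 0`
and `V'(t) ≤ -α·V(t) + β·V(t)^{3/2}` for all `t ≥ 0`. If `V(0) < (α/(2β))²`, then
`V(t) < (α/(2β))²` for all `t ≥ 0`, and `V(t) ≤ V(0)·e^{-(α/2)·t}` for all `t ≥ 0`. -/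
theorem lyapunov_local_decay (α β : ℝ) (hα : 0 < α) (hβ : 0 < β)
    (V : ℝ → ℝ)
    (hVdiff : ∀ t : ℝ, 0 ≤ t → DifferentiableAt ℝ V t)
    (hVnonneg : ∀ t : ℝ, 0 ≤ t → 0 ≤ V t)
    (hVineq : ∀ t : ℝ, 0 ≤ t → deriv V t ≤ -α * V t + β * V t ^ ((3:ℝ)/2))
    (hV0 : V 0 < (α / (2 * β)) ^ 2) :
    (∀ t : ℝ, 0 ≤ t → V t < (α / (2 * β)) ^ 2) ∧
    (∀ t : ℝ, 0 ≤ t → V t ≤ V 0 * Real.exp (-(α / 2) * t)) := by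
  have key : ∀ c : ℝ, 0 < c → V 0 ≤ c → c < (α / (2 * β)) ^ 2 → ∀ t : ℝ, 0 ≤ t →
      V t ≤ c * Real.exp (-(α / 2) * t) := by
    intro c hc h0 hcK t ht
    have hB : ∀ x : ℝ, HasDerivAt (fun x => c * Real.exp (-(α / 2) * x))
        (c * (Real.exp (-(α / 2) * x) * (-(α / 2)))) x := by
      intro x
      have h1 : HasDerivAt (fun x : ℝ => -(α / 2) * x) (-(α / 2)) x := by
        simpa using (hasDerivAt_id x).const_mul (-(α / 2))
      exact h1.exp.const_mul c
    refine image_le_of_deriv_right_lt_deriv_boundary (f := V) (f' := deriv V) (a := 0) (b := t)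
      (fun x hx => (hVdiff x hx.1).continuousAt.continuousWithinAt)
      (fun x hx => (hVdiff x hx.1).hasDerivAt.hasDerivWithinAt) (by simpa using h0) hB ?_
      (Set.right_mem_Icc.2 ht)
    intro x hx hEq
    have he : Real.exp (-(α / 2) * x) ≤ 1 := by
      apply Real.exp_le_one_iff.2
      nlinarith [hx.1]
    have hpos : 0 < V x := by
      rw [hEq]
      positivity
    have hlt : V x < (α / (2 * β)) ^ 2 := by
      rw [hEq]
      nlinarith
    have hs : Real.sqrt (V x) < α / (2 * β) := (Real.sqrt_lt' (by positivity)).2 hlt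
    have hs2 : β * Real.sqrt (V x) < α / 2 := by
      have := mul_lt_mul_of_pos_left hs hβ
      have h2 : β * (α / (2 * β)) = α / 2 := by field_simp
      linarith
    have hp : V x ^ ((3:ℝ)/2) = V x * Real.sqrt (V x) := by
      rw [show (3:ℝ)/2 = 1 + 1/2 by norm_num, Real.rpow_add hpos, Real.rpow_one,
        Real.sqrt_eq_rpow]
    have hd := hVineq x hx.1
    rw [hp] at hd
    have h3 : c * (Real.exp (-(α / 2) * x) * (-(α / 2))) = -(α / 2) * V x := by
      rw [hEq]
      ring
    rw [h3]
    nlinarith [mul_lt_mul_of_pos_left hs2 hpos]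
  have h00 := hVnonneg 0 le_rfl
  constructor
  · intro t ht
    have h := key ((V 0 + (α / (2 * β)) ^ 2) / 2) (by linarith) (by linarith) (by linarith) t ht
    have he : Real.exp (-(α / 2) * t) ≤ 1 := by
      apply Real.exp_le_one_iff.2
      nlinarith
    nlinarith
  · intro t ht
    have he : Real.exp (-(α / 2) * t) ≤ 1 := by
      apply Real.exp_le_one_iff.2
      nlinarith
    have hepos := Real.exp_pos (-(α / 2) * t)
    by_contra! hcon
    obtain ⟨ε, hε, hε2⟩ := exists_between (lt_min (sub_pos.2 hV0) (sub_pos.2 hcon))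
    have h1 := hε2.trans_le (min_le_left _ _)
    have h2 := hε2.trans_le (min_le_right _ _)
    have h := key (V 0 + ε) (by linarith) (by linarith) (by linarith) t ht
    nlinarith
end
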